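/- arXiv:2410.00142 — 4 statements merged into one kernel-verified Lean document; each statement's English description precedes it below -/
import Mathlib

section
/- Let n ≥ 1 and x₁,…,xₙ > 0. Let π_α : (0,∞) → (0,∞) be measurable and let π_η : (0,∞) → (0,∞) be continuous, and suppose there exists r₀ ≤ −1 such that π_η(η) ∝_{η→0⁺} η^{r₀}. Then the posterior is improper: d(x) = +∞. -/
open MeasureTheory Filter Set

/-- The modified Bessel function of the first kind of order 0:
`I₀(x) = ∑ (x/2)^(2m) / (m!)²`. -/
noncomputable def besselI0 (x : ℝ) : ℝ :=
  ∑' m : ℕ, (x / 2) ^ (2 * m) / ((Nat.factorial m : ℝ)) ^ 2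

/-- `a(t) ∝ b(t)` along the filter `l`: the liminf of `a/b` is positive and the
limsup of `a/b` is finite (computed in `[0,∞]`). -/
def PropAt (a b : ℝ → ℝ) (l : Filter ℝ) : Prop :=
  0 < Filter.liminf (fun t => ENNReal.ofReal (a t / b t)) l ∧
    Filter.limsup (fun t => ENNReal.ofReal (a t / b t)) l < ⊤

/-- The Rician posterior normalizing constant
`d(x) = ∫₀^∞ ∫₀^∞ π_α(α) π_η(η) ∏ᵢ [(xᵢ/α²) I₀(η xᵢ/α²)] exp(−∑ᵢ (xᵢ² + η²)/(2α²)) dη dα`,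
as a Lebesgue integral with values in `[0,∞]`. -/
noncomputable def ricianD (n : ℕ) (x : Fin n → ℝ) (πα πη : ℝ → ℝ) : ENNReal :=
  ∫⁻ α in Set.Ioi (0 : ℝ), ∫⁻ η in Set.Ioi (0 : ℝ),
    ENNReal.ofReal (πα α * πη η *
      (∏ i, (x i / α ^ 2) * besselI0 (η * x i / α ^ 2)) *
      Real.exp (-(∑ i, (x i ^ 2 + η ^ 2) / (2 * α ^ 2))))

theorem one_le_besselI0 (x : ℝ) : 1 ≤ besselI0 x := by
  have hnonneg : ∀ m : ℕ, 0 ≤ (x / 2) ^ (2 * m) / ((Nat.factorial m : ℝ)) ^ 2 := fun m => by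
    rw [pow_mul]; positivity
  have hsum : Summable fun m : ℕ => (x / 2) ^ (2 * m) / ((Nat.factorial m : ℝ)) ^ 2 := by
    refine Summable.of_nonneg_of_le hnonneg (fun m => ?_)
      (Real.summable_pow_div_factorial ((x / 2) ^ 2))
    have h1 : (1 : ℝ) ≤ Nat.factorial m := by exact_mod_cast Nat.factorial_pos m
    rw [pow_mul]
    gcongr
    exact le_self_pow₀ h1 two_ne_zero
  simpa [besselI0] using hsum.le_tsum 0 (fun m _ => hnonneg m)

/-- Proportionality gives an eventual lower bound by a positive multiple. -/
theorem PropAt.exists_eventually_mul_le {a b : ℝ → ℝ} {l : Filter ℝ} (h : PropAt a b l)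
    (hb : ∀ᶠ t in l, 0 < b t) : ∃ c : ℝ, 0 < c ∧ ∀ᶠ t in l, c * b t ≤ a t := by
  obtain ⟨c, hc0, hc⟩ := exists_between h.1
  have hctop : c ≠ ⊤ := hc.ne_top
  refine ⟨c.toReal, ENNReal.toReal_pos hc0.ne' hctop, ?_⟩
  filter_upwards [eventually_lt_of_lt_liminf hc, hb] with t ht hbt
  rw [← le_div_iff₀ hbt]
  exact ((ENNReal.lt_ofReal_iff_toReal_lt hctop).1 ht).le

theorem lintegral_Ioo_const_mul_rpow_eq_top {c r t : ℝ} (hc : 0 < c) (hr : r ≤ -1) (ht : 0 < t) :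
    ∫⁻ η in Ioo 0 t, ENNReal.ofReal (c * η ^ r) = ⊤ := by
  by_contra hfin
  have hint : Integrable (fun η : ℝ => c * η ^ r) (volume.restrict (Ioo 0 t)) := by
    refine ⟨by fun_prop, ?_⟩
    rw [hasFiniteIntegral_iff_ofReal]
    · exact lt_top_iff_ne_top.2 hfin
    · filter_upwards [ae_restrict_mem measurableSet_Ioo] with η hη
      exact mul_nonneg hc.le (Real.rpow_nonneg hη.1.le r)
  have hpow : IntegrableOn (fun η : ℝ => η ^ r) (Ioo 0 t) :=
    (integrable_const_mul_iff (isUnit_iff_ne_zero.2 hc.ne') _).1 hint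
  exact absurd ((intervalIntegral.integrableOn_Ioo_rpow_iff ht).1 hpow) hr.not_gt

/-- The Rician likelihood at scale `α` is bounded below by a positive constant for `η ∈ (0, 1]`. -/
theorem exists_pos_le_rician_likelihood {n : ℕ} {x : Fin n → ℝ} (hx : ∀ i, 0 < x i) {α : ℝ}
    (hα : 0 < α) : ∃ K : ℝ, 0 < K ∧ ∀ η : ℝ, 0 < η → η ≤ 1 →
      K ≤ (∏ i, (x i / α ^ 2) * besselI0 (η * x i / α ^ 2)) *
        Real.exp (-(∑ i, (x i ^ 2 + η ^ 2) / (2 * α ^ 2))) := by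
  have hpos : ∀ i, 0 < x i / α ^ 2 := fun i => div_pos (hx i) (by positivity)
  refine ⟨(∏ i, x i / α ^ 2) * Real.exp (-(∑ i, (x i ^ 2 + 1) / (2 * α ^ 2))),
    mul_pos (Finset.prod_pos fun i _ => hpos i) (Real.exp_pos _), fun η hη hη1 => ?_⟩
  have hprod : ∏ i, x i / α ^ 2 ≤ ∏ i, (x i / α ^ 2) * besselI0 (η * x i / α ^ 2) :=
    Finset.prod_le_prod (fun i _ => (hpos i).le)
      fun i _ => le_mul_of_one_le_right (hpos i).le (one_le_besselI0 _)
  have hsq : η ^ 2 ≤ 1 := pow_le_one₀ hη.le hη1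
  refine mul_le_mul hprod ?_ (Real.exp_pos _).le
    ((Finset.prod_nonneg fun i _ => (hpos i).le).trans hprod)
  gcongr

theorem stmt_2 (n : ℕ) (hn : 1 ≤ n) (x : Fin n → ℝ) (hx : ∀ i, 0 < x i)
    (πα πη : ℝ → ℝ) (hπα : Measurable πα) (hπαpos : ∀ α : ℝ, 0 < α → 0 < πα α)
    (hπη : ContinuousOn πη (Set.Ioi 0)) (hπηpos : ∀ η : ℝ, 0 < η → 0 < πη η)
    (r₀ : ℝ) (hr₀ : r₀ ≤ -1)
    (hprop : PropAt πη (fun η => η ^ r₀) (nhdsWithin 0 (Set.Ioi 0))) :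
    ricianD n x πα πη = ⊤ := by
  have hb : ∀ᶠ η : ℝ in nhdsWithin 0 (Ioi 0), 0 < η ^ r₀ := by
    filter_upwards [self_mem_nhdsWithin] with η hη using Real.rpow_pos_of_pos hη r₀
  obtain ⟨c, hc, hev⟩ := hprop.exists_eventually_mul_le hb
  obtain ⟨δ, hδ, hle⟩ := mem_nhdsGT_iff_exists_Ioo_subset.1 hev
  have hinner : ∀ α ∈ Ioi (0 : ℝ), ∫⁻ η in Ioi (0 : ℝ),
      ENNReal.ofReal (πα α * πη η *
        (∏ i, (x i / α ^ 2) * besselI0 (η * x i / α ^ 2)) *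
        Real.exp (-(∑ i, (x i ^ 2 + η ^ 2) / (2 * α ^ 2)))) = ⊤ := by
    intro α hα
    obtain ⟨K, hK, hlik⟩ := exists_pos_le_rician_likelihood hx hα
    have hA := hπαpos α hα
    rw [eq_top_iff, ← lintegral_Ioo_const_mul_rpow_eq_top
      (mul_pos (mul_pos hA hc) hK) hr₀ (lt_min hδ one_pos)]
    refine (setLIntegral_mono' measurableSet_Ioo fun η hη => ENNReal.ofReal_le_ofReal ?_).trans
      (lintegral_mono_set Ioo_subset_Ioi_self)
    have hη1 : c * η ^ r₀ ≤ πη η := hle ⟨hη.1, hη.2.trans_le (min_le_left _ _)⟩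
    have hη2 := hlik η hη.1 (hη.2.le.trans (min_le_right _ _))
    rw [mul_assoc (πα α * πη η)]
    calc πα α * c * K * η ^ r₀ = πα α * (c * η ^ r₀) * K := by ring
      _ ≤ _ := mul_le_mul (mul_le_mul_of_nonneg_left hη1 hA.le) hη2 hK.le
        (mul_nonneg hA.le (hπηpos η hη.1).le)
  rw [ricianD, setLIntegral_congr_fun measurableSet_Ioi hinner]
  simp
end

section
/- Let n ≥ 2 and x₁,…,xₙ > 0 be such that not all the x_i are equal. Let k, r₀, r∞ ∈ ℝ, let π_α : (0,∞) → (0,∞) satisfy π_α(α) ∝ α^k on (0,∞), and let π_η : (0,∞) → (0,∞) be continuous with π_η(η) ∝_{η→0⁺} η^{r₀} and π_η(η) ∝_{η→∞} η^{r∞}, where r₀ > −1. If n > max(2(r∞+1), k+1), then the posterior is proper: d(x) < ∞. -/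
open MeasureTheory Filter Set

/-- `a ∝ b` on a set `I`: there are constants `0 < K₀ ≤ K₁` with
`K₀ b(t) ≤ a(t) ≤ K₁ b(t)` on `I`. -/
def PropOn (a b : ℝ → ℝ) (I : Set ℝ) : Prop :=
  ∃ K₀ K₁ : ℝ, 0 < K₀ ∧ K₀ ≤ K₁ ∧ ∀ t ∈ I, K₀ * b t ≤ a t ∧ a t ≤ K₁ * b t

/-- The central binomial coefficient satisfies `C(2m, m)² (2m + 1) ≤ 16 ^ m`. -/
theorem centralBinom_sq_mul_le (m : ℕ) : m.centralBinom ^ 2 * (2 * m + 1) ≤ 16 ^ m := by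
  induction m with
  | zero => simp
  | succ m ih =>
    have h := Nat.succ_mul_centralBinom_succ m
    have h2 : (m + 1) ^ 2 * ((m + 1).centralBinom ^ 2 * (2 * (m + 1) + 1))
        ≤ (m + 1) ^ 2 * 16 ^ (m + 1) := by
      calc (m + 1) ^ 2 * ((m + 1).centralBinom ^ 2 * (2 * (m + 1) + 1))
          = ((m + 1) * (m + 1).centralBinom) ^ 2 * (2 * (m + 1) + 1) := by ring
        _ = (4 * (2 * m + 1) * (2 * m + 3)) * (m.centralBinom ^ 2 * (2 * m + 1)) := by
            rw [h]; ring
        _ ≤ (16 * (m + 1) ^ 2) * 16 ^ m := Nat.mul_le_mul (by nlinarith) ih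
        _ = (m + 1) ^ 2 * 16 ^ (m + 1) := by ring
    exact Nat.le_of_mul_le_mul_left h2 (by positivity)

theorem centralBinom_cast_mul_factorial_sq (m : ℕ) :
    (m.centralBinom : ℝ) * (m.factorial : ℝ) ^ 2 = ((2 * m).factorial : ℝ) := by
  have h := Nat.choose_mul_factorial_mul_factorial (n := 2 * m) (k := m) (by lia)
  rw [show 2 * m - m = m by lia] at h
  rw [Nat.centralBinom_eq_two_mul_choose, sq, ← mul_assoc]
  exact_mod_cast h

theorem besselI0_term_eq (t : ℝ) (m : ℕ) :
    (t / 2) ^ (2 * m) / (m.factorial : ℝ) ^ 2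
      = t ^ (2 * m) / ((2 * m).factorial : ℝ) * (m.centralBinom / 4 ^ m) := by
  have h := centralBinom_cast_mul_factorial_sq m
  have h1 : (m.factorial : ℝ) ≠ 0 := by positivity
  have h2 : (m.centralBinom : ℝ) ≠ 0 := by exact_mod_cast Nat.centralBinom_ne_zero m
  rw [← h, div_pow, pow_mul (2 : ℝ)]
  norm_num
  field_simp

theorem centralBinom_div_four_pow_mul_sqrt_le (m : ℕ) :
    (m.centralBinom / 4 ^ m : ℝ) * √(2 * m + 1) ≤ 1 := by
  have h : (m.centralBinom : ℝ) ^ 2 * (2 * m + 1) ≤ 16 ^ m := by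
    exact_mod_cast centralBinom_sq_mul_le m
  refine (le_abs_self _).trans (abs_le_one_iff_mul_self_le_one.2 ?_)
  have h3 : √(2 * m + 1 : ℝ) * √(2 * m + 1) = 2 * m + 1 := Real.mul_self_sqrt (by positivity)
  calc (m.centralBinom / 4 ^ m : ℝ) * √(2 * m + 1) * (m.centralBinom / 4 ^ m * √(2 * m + 1))
      = (m.centralBinom : ℝ) ^ 2 / (4 ^ m * 4 ^ m) * (√(2 * m + 1) * √(2 * m + 1)) := by
        field_simp
    _ = (m.centralBinom : ℝ) ^ 2 * (2 * m + 1) / 16 ^ m := by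
        rw [h3, ← mul_pow]; norm_num; ring
    _ ≤ 1 := div_le_one_of_le₀ h (by positivity)

theorem centralBinom_div_four_pow_le_one (m : ℕ) : (m.centralBinom / 4 ^ m : ℝ) ≤ 1 := by
  refine le_trans ?_ (centralBinom_div_four_pow_mul_sqrt_le m)
  refine le_mul_of_one_le_right (by positivity) ?_
  rw [Real.one_le_sqrt]
  have : (0 : ℝ) ≤ m := by positivity
  linarith

theorem besselI0_term_le (t : ℝ) (m : ℕ) :
    (t / 2) ^ (2 * m) / (m.factorial : ℝ) ^ 2 ≤ t ^ (2 * m) / ((2 * m).factorial : ℝ) := by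
  rw [besselI0_term_eq]
  refine mul_le_of_le_one_right ?_ (centralBinom_div_four_pow_le_one m)
  rw [pow_mul]
  positivity

theorem besselI0_term_nonneg (t : ℝ) (m : ℕ) :
    0 ≤ (t / 2) ^ (2 * m) / (m.factorial : ℝ) ^ 2 := by
  rw [pow_mul]
  positivity

theorem summable_besselI0 (t : ℝ) :
    Summable fun m : ℕ => (t / 2) ^ (2 * m) / (m.factorial : ℝ) ^ 2 :=
  (Real.hasSum_cosh t).summable.of_nonneg_of_le (besselI0_term_nonneg t) (besselI0_term_le t)

theorem besselI0_nonneg (t : ℝ) : 0 ≤ besselI0 t :=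
  tsum_nonneg (besselI0_term_nonneg t)

theorem besselI0_le_exp {t : ℝ} (ht : 0 ≤ t) : besselI0 t ≤ Real.exp t := by
  calc besselI0 t ≤ Real.cosh t :=
        hasSum_le (besselI0_term_le t) (summable_besselI0 t).hasSum (Real.hasSum_cosh t)
    _ ≤ Real.exp t := by
        rw [← Real.cosh_add_sinh]
        linarith [Real.sinh_nonneg_iff.2 ht]

theorem besselI0_mul_sqrt_le_exp {t : ℝ} (ht : 0 ≤ t) : besselI0 t * √t ≤ Real.exp t := by
  have hsum := (Real.hasSum_cosh t).add (Real.hasSum_sinh t)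
  rw [Real.cosh_add_sinh] at hsum
  refine hasSum_le (fun m => ?_) ((summable_besselI0 t).hasSum.mul_right √t) hsum
  have hs : 0 < √(2 * m + 1 : ℝ) := Real.sqrt_pos.2 (by positivity)
  have hs2 : √(2 * m + 1 : ℝ) ^ 2 = 2 * m + 1 := Real.sq_sqrt (by positivity)
  have ht2 : √t ^ 2 = t := Real.sq_sqrt ht
  have hc := centralBinom_div_four_pow_mul_sqrt_le m
  have hc' : (m.centralBinom / 4 ^ m : ℝ) * √t ≤ 1 + t / (2 * m + 1) := by
    calc (m.centralBinom / 4 ^ m : ℝ) * √t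
        = (m.centralBinom / 4 ^ m : ℝ) * √(2 * m + 1) * (√t / √(2 * m + 1)) := by
          field_simp
      _ ≤ 1 * (√t / √(2 * m + 1)) := mul_le_mul_of_nonneg_right hc (by positivity)
      _ ≤ 1 + (√t / √(2 * m + 1)) ^ 2 := by
          nlinarith [sq_nonneg (√t / √(2 * m + 1 : ℝ) - 1), sq_nonneg (√t / √(2 * m + 1 : ℝ))]
      _ = 1 + t / (2 * m + 1) := by rw [div_pow, hs2, ht2]
  have hfac : ((2 * m + 1).factorial : ℝ) = (2 * m + 1) * (2 * m).factorial := by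
    rw [Nat.factorial_succ]; push_cast; ring
  rw [besselI0_term_eq, mul_assoc]
  calc t ^ (2 * m) / ((2 * m).factorial : ℝ) * (m.centralBinom / 4 ^ m * √t)
      ≤ t ^ (2 * m) / ((2 * m).factorial : ℝ) * (1 + t / (2 * m + 1)) :=
        mul_le_mul_of_nonneg_left hc' (by positivity)
    _ = t ^ (2 * m) / ((2 * m).factorial : ℝ) + t ^ (2 * m + 1) / ((2 * m + 1).factorial : ℝ) := by
        rw [hfac, pow_succ]
        field_simp

theorem besselI0_le_exp_mul_rpow {t : ℝ} (ht : 0 < t) :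
    besselI0 t ≤ Real.exp t * t ^ (-(1 / 2) : ℝ) := by
  rw [Real.rpow_neg ht.le, ← Real.sqrt_eq_rpow, ← div_eq_mul_inv, le_div_iff₀ (Real.sqrt_pos.2 ht)]
  exact besselI0_mul_sqrt_le_exp ht.le

/-- Finiteness of `∫₀^∞ α ^ q exp (-c / α²) dα` when `q < -1` and `c > 0`. -/
theorem lintegral_rpow_mul_exp_neg_div_sq_lt_top {q c : ℝ} (hq : q < -1) (hc : 0 < c) :
    ∫⁻ α in Ioi (0 : ℝ), ENNReal.ofReal (α ^ q * Real.exp (-(c / α ^ 2))) < ⊤ := by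
  obtain ⟨N, hN⟩ := exists_nat_ge (-q)
  rw [← Ioc_union_Ioi_eq_Ioi zero_le_one]
  refine (lintegral_union_le _ _ _).trans_lt (ENNReal.add_lt_top.2 ⟨?_, ?_⟩)
  · calc ∫⁻ α in Ioc (0 : ℝ) 1, ENNReal.ofReal (α ^ q * Real.exp (-(c / α ^ 2)))
        ≤ ∫⁻ _ in Ioc (0 : ℝ) 1, ENNReal.ofReal (N.factorial / c ^ N) := by
          refine setLIntegral_mono' measurableSet_Ioc fun α hα => ENNReal.ofReal_le_ofReal ?_
          have hα0 : 0 < α := hα.1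
          have h1 := Real.pow_div_factorial_le_exp (c / α ^ 2) (by positivity) N
          have h2 : Real.exp (-(c / α ^ 2)) ≤ N.factorial / (c / α ^ 2) ^ N := by
            rw [Real.exp_neg, ← inv_div ((c / α ^ 2) ^ N)]
            exact inv_anti₀ (by positivity) h1
          have h3 : α ^ q * α ^ (2 * N) ≤ 1 := by
            rw [← Real.rpow_natCast, ← Real.rpow_add hα0]
            refine Real.rpow_le_one hα0.le hα.2 ?_
            push_cast
            linarith [(Nat.cast_nonneg N : (0 : ℝ) ≤ N)]
          calc α ^ q * Real.exp (-(c / α ^ 2))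
              ≤ α ^ q * (N.factorial / (c / α ^ 2) ^ N) :=
                mul_le_mul_of_nonneg_left h2 (by positivity)
            _ = (α ^ q * α ^ (2 * N)) * (N.factorial / c ^ N) := by
                rw [div_pow, ← pow_mul]; field_simp
            _ ≤ 1 * (N.factorial / c ^ N) := mul_le_mul_of_nonneg_right h3 (by positivity)
            _ = N.factorial / c ^ N := one_mul _
      _ < ⊤ := by simp
  · calc ∫⁻ α in Ioi (1 : ℝ), ENNReal.ofReal (α ^ q * Real.exp (-(c / α ^ 2)))
        ≤ ∫⁻ α in Ioi (1 : ℝ), ENNReal.ofReal (α ^ q) := by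
          refine setLIntegral_mono' measurableSet_Ioi fun α hα => ENNReal.ofReal_le_ofReal ?_
          have hα0 : 0 < α := zero_lt_one.trans hα
          refine mul_le_of_le_one_right (by positivity) (Real.exp_le_one_iff.2 ?_)
          rw [neg_nonpos]
          positivity
      _ < ⊤ := (integrableOn_Ioi_rpow_of_lt hq zero_lt_one).setLIntegral_lt_top

/-- Upper half of `PropAt`: eventually `a` is at most a constant multiple of `b`. -/
theorem PropAt.exists_eventually_le_mul {a b : ℝ → ℝ} {l : Filter ℝ} (h : PropAt a b l)
    (hb : ∀ᶠ t in l, 0 < b t) : ∃ M : ℝ, ∀ᶠ t in l, a t ≤ M * b t := by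
  obtain ⟨M, hM, hMtop⟩ := exists_between h.2
  refine ⟨M.toReal, ?_⟩
  filter_upwards [eventually_lt_of_limsup_lt hM, hb] with t ht hbt
  rw [← div_le_iff₀ hbt]
  exact (ENNReal.ofReal_le_iff_le_toReal hMtop.ne).1 ht.le

theorem exists_le_mul_rpow_on_Icc {f : ℝ → ℝ} (hf : ContinuousOn f (Ioi 0)) (r : ℝ) {u v : ℝ}
    (hu : 0 < u) : ∃ M : ℝ, ∀ t ∈ Icc u v, f t ≤ M * t ^ r := by
  have hsub : Icc u v ⊆ Ioi 0 := fun t ht => hu.trans_le ht.1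
  have hcont : ContinuousOn (fun t => f t / t ^ r) (Icc u v) :=
    (hf.mono hsub).div
      (continuousOn_id.rpow_const fun t ht => Or.inl (hsub ht).ne')
      fun t ht => (Real.rpow_pos_of_pos (hsub ht) r).ne'
  obtain ⟨M, hM⟩ := isCompact_Icc.bddAbove_image hcont
  refine ⟨M, fun t ht => ?_⟩
  rw [← div_le_iff₀ (Real.rpow_pos_of_pos (hsub ht) r)]
  exact hM (mem_image_of_mem _ ht)

theorem exists_le_mul_rpow_on_Ioc {f : ℝ → ℝ} (hf : ContinuousOn f (Ioi 0)) {r : ℝ}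
    (h : PropAt f (fun t => t ^ r) (nhdsWithin 0 (Ioi 0))) :
    ∃ M : ℝ, ∀ t ∈ Ioc (0 : ℝ) 1, f t ≤ M * t ^ r := by
  obtain ⟨M₁, hM₁⟩ := h.exists_eventually_le_mul
    (eventually_mem_nhdsWithin.mono fun t ht => Real.rpow_pos_of_pos ht r)
  obtain ⟨δ, hδ, hδM⟩ := mem_nhdsGT_iff_exists_Ioo_subset.1 hM₁
  obtain ⟨M₂, hM₂⟩ := exists_le_mul_rpow_on_Icc hf r (v := 1) hδ
  refine ⟨max M₁ M₂, fun t ht => ?_⟩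
  have hpos := (Real.rpow_pos_of_pos ht.1 r).le
  rcases lt_or_ge t δ with htδ | htδ
  · exact (hδM ⟨ht.1, htδ⟩ : f t ≤ M₁ * t ^ r).trans
      (mul_le_mul_of_nonneg_right (le_max_left _ _) hpos)
  · exact (hM₂ t ⟨htδ, ht.2⟩).trans (mul_le_mul_of_nonneg_right (le_max_right _ _) hpos)

theorem exists_le_mul_rpow_on_Ioi {f : ℝ → ℝ} (hf : ContinuousOn f (Ioi 0)) {r : ℝ}
    (h : PropAt f (fun t => t ^ r) atTop) :
    ∃ M : ℝ, ∀ t ∈ Ioi (1 : ℝ), f t ≤ M * t ^ r := by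
  obtain ⟨M₁, hM₁⟩ := h.exists_eventually_le_mul
    ((eventually_gt_atTop 0).mono fun t ht => Real.rpow_pos_of_pos ht r)
  obtain ⟨T, hT⟩ := eventually_atTop.1 hM₁
  obtain ⟨M₂, hM₂⟩ := exists_le_mul_rpow_on_Icc hf r (v := T) zero_lt_one
  refine ⟨max M₁ M₂, fun t ht => ?_⟩
  have hpos := (Real.rpow_pos_of_pos (zero_lt_one.trans ht) r).le
  rcases le_total T t with htT | htT
  · exact (hT t htT).trans (mul_le_mul_of_nonneg_right (le_max_left _ _) hpos)
  · exact (hM₂ t ⟨le_of_lt ht, htT⟩).trans (mul_le_mul_of_nonneg_right (le_max_right _ _) hpos)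

theorem sq_sub_div_two_le_sum_sq_sub {n : ℕ} (x : Fin n → ℝ) {i j : Fin n} (hij : i ≠ j)
    (η : ℝ) : (x i - x j) ^ 2 / 2 ≤ ∑ l, (x l - η) ^ 2 := by
  calc (x i - x j) ^ 2 / 2 ≤ (x i - η) ^ 2 + (x j - η) ^ 2 := by
        nlinarith [sq_nonneg (x i + x j - 2 * η)]
    _ = ∑ l ∈ {i, j}, (x l - η) ^ 2 := by rw [Finset.sum_pair hij]
    _ ≤ ∑ l, (x l - η) ^ 2 :=
        Finset.sum_le_sum_of_subset_of_nonneg (Finset.subset_univ _) fun l _ _ => sq_nonneg _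

/-- The Rician likelihood is dominated by a product of a function of `α` and a function of `η`,
given a bound `I₀ t ≤ exp t * t ^ (-s)`. -/
theorem rician_likelihood_le {n : ℕ} {x : Fin n → ℝ} (hx : ∀ i, 0 < x i) {i j : Fin n}
    (hij : i ≠ j) {s : ℝ} (hs : ∀ t : ℝ, 0 < t → besselI0 t ≤ Real.exp t * t ^ (-s))
    {α η : ℝ} (hα : 0 < α) (hη : 0 < η) :
    (∏ l, (x l / α ^ 2) * besselI0 (η * x l / α ^ 2)) *
        Real.exp (-(∑ l, (x l ^ 2 + η ^ 2) / (2 * α ^ 2)))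
      ≤ (∏ l, x l ^ (1 - s)) * (α ^ (-(2 * n * (1 - s))) *
          Real.exp (-((x i - x j) ^ 2 / 4 / α ^ 2))) * η ^ (-(s * n)) := by
  have hfactor : ∀ l, (x l / α ^ 2) * besselI0 (η * x l / α ^ 2) ≤
      Real.exp (η * x l / α ^ 2) * (x l ^ (1 - s) * (α ^ (-(2 * (1 - s))) * η ^ (-s))) := by
    intro l
    have hxl := hx l
    calc (x l / α ^ 2) * besselI0 (η * x l / α ^ 2)
        ≤ (x l / α ^ 2) *
          (Real.exp (η * x l / α ^ 2) * (η * x l / α ^ 2) ^ (-s)) :=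
          mul_le_mul_of_nonneg_left (hs _ (by positivity)) (by positivity)
      _ = Real.exp (η * x l / α ^ 2) * ((x l / α ^ 2) ^ (1 - s) * η ^ (-s)) := by
          rw [mul_div_assoc, Real.mul_rpow hη.le (by positivity), sub_eq_add_neg,
            Real.rpow_add (by positivity : 0 < x l / α ^ 2), Real.rpow_one]
          ring
      _ = _ := by
          rw [Real.div_rpow hxl.le (by positivity), ← Real.rpow_natCast α 2,
            ← Real.rpow_mul hα.le, Real.rpow_neg hα.le]
          push_cast
          ring
  have hexp : (∑ l, η * x l / α ^ 2) + -(∑ l, (x l ^ 2 + η ^ 2) / (2 * α ^ 2))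
      ≤ -((x i - x j) ^ 2 / 4 / α ^ 2) := by
    have h := sq_sub_div_two_le_sum_sq_sub x hij η
    have heq : (∑ l, η * x l / α ^ 2) + -(∑ l, (x l ^ 2 + η ^ 2) / (2 * α ^ 2))
        = -((∑ l, (x l - η) ^ 2) / (2 * α ^ 2)) := by
      rw [← sub_eq_add_neg, ← Finset.sum_sub_distrib, Finset.sum_div, ← Finset.sum_neg_distrib]
      refine Finset.sum_congr rfl fun l _ => ?_
      field_simp
      ring
    rw [heq, neg_le_neg_iff]
    calc (x i - x j) ^ 2 / 4 / α ^ 2 = (x i - x j) ^ 2 / 2 / (2 * α ^ 2) := by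
          field_simp; norm_num
      _ ≤ _ := by gcongr
  have hprod : ∏ l, (Real.exp (η * x l / α ^ 2) *
        (x l ^ (1 - s) * (α ^ (-(2 * (1 - s))) * η ^ (-s))))
      = Real.exp (∑ l, η * x l / α ^ 2) *
        ((∏ l, x l ^ (1 - s)) * (α ^ (-(2 * n * (1 - s))) * η ^ (-(s * n)))) := by
    rw [Finset.prod_mul_distrib, Finset.prod_mul_distrib, ← Real.exp_sum, Finset.prod_const,
      Finset.card_univ, Fintype.card_fin, mul_pow, ← Real.rpow_mul_natCast hα.le,
      ← Real.rpow_mul_natCast hη.le, show -(2 * (1 - s)) * n = -(2 * n * (1 - s)) by ring,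
      neg_mul]
  have hP : 0 ≤ ∏ l, x l ^ (1 - s) :=
    Finset.prod_nonneg fun l _ => Real.rpow_nonneg (hx l).le _
  calc _ ≤ (∏ l, (Real.exp (η * x l / α ^ 2) *
          (x l ^ (1 - s) * (α ^ (-(2 * (1 - s))) * η ^ (-s))))) *
        Real.exp (-(∑ l, (x l ^ 2 + η ^ 2) / (2 * α ^ 2))) := by
        refine mul_le_mul_of_nonneg_right (Finset.prod_le_prod (fun l _ => ?_) fun l _ => hfactor l)
          (Real.exp_pos _).le
        have := hx l
        have := besselI0_nonneg (η * x l / α ^ 2)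
        positivity
    _ = (∏ l, x l ^ (1 - s)) * (α ^ (-(2 * n * (1 - s))) * η ^ (-(s * n))) *
        Real.exp ((∑ l, η * x l / α ^ 2) + -(∑ l, (x l ^ 2 + η ^ 2) / (2 * α ^ 2))) := by
        rw [hprod, Real.exp_add]; ring
    _ ≤ (∏ l, x l ^ (1 - s)) * (α ^ (-(2 * n * (1 - s))) * η ^ (-(s * n))) *
        Real.exp (-((x i - x j) ^ 2 / 4 / α ^ 2)) := by
        gcongr
    _ = _ := by ring

/-- Bound of the inner `η`-integral over a set `S` on which `π_η ≤ M η ^ r`. -/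
theorem lintegral_rician_le {n : ℕ} {x : Fin n → ℝ} (hx : ∀ i, 0 < x i) {i j : Fin n}
    (hij : i ≠ j) {s : ℝ} (hs : ∀ t : ℝ, 0 < t → besselI0 t ≤ Real.exp t * t ^ (-s))
    {πα πη : ℝ → ℝ} {k K M r : ℝ} {S : Set ℝ} (hS : MeasurableSet S) (hS0 : S ⊆ Ioi 0)
    (hπη0 : ∀ η ∈ S, 0 ≤ πη η) (hπη : ∀ η ∈ S, πη η ≤ M * η ^ r)
    {α : ℝ} (hα : 0 < α) (hπα0 : 0 ≤ πα α) (hπα : πα α ≤ K * α ^ k) :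
    ∫⁻ η in S, ENNReal.ofReal (πα α * πη η *
        (∏ l, (x l / α ^ 2) * besselI0 (η * x l / α ^ 2)) *
        Real.exp (-(∑ l, (x l ^ 2 + η ^ 2) / (2 * α ^ 2))))
      ≤ ENNReal.ofReal (α ^ (k - 2 * n * (1 - s)) * Real.exp (-((x i - x j) ^ 2 / 4 / α ^ 2))) *
        (ENNReal.ofReal (K * ∏ l, x l ^ (1 - s)) *
          ∫⁻ η in S, ENNReal.ofReal (M * η ^ (r - s * n))) := by
  have hP : 0 ≤ ∏ l, x l ^ (1 - s) :=
    Finset.prod_nonneg fun l _ => Real.rpow_nonneg (hx l).le _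
  have hK : 0 ≤ K := by
    have := hπα0.trans hπα
    exact nonneg_of_mul_nonneg_left this (Real.rpow_pos_of_pos hα k)
  rw [← mul_assoc, ← ENNReal.ofReal_mul (by positivity),
    ← lintegral_const_mul' _ _ ENNReal.ofReal_ne_top]
  refine setLIntegral_mono' hS fun η hη => ?_
  have hη0 : 0 < η := hS0 hη
  rw [← ENNReal.ofReal_mul (by positivity)]
  refine ENNReal.ofReal_le_ofReal ?_
  have hL := rician_likelihood_le hx hij hs hα hη0
  rw [mul_assoc]
  calc πα α * πη η * _
      ≤ (K * α ^ k) * (M * η ^ r) * _ := by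
        refine mul_le_mul (mul_le_mul hπα (hπη η hη) (hπη0 η hη) (by positivity)) hL ?_ ?_
        · refine mul_nonneg (Finset.prod_nonneg fun l _ => ?_) (Real.exp_pos _).le
          have := hx l
          have := besselI0_nonneg (η * x l / α ^ 2)
          positivity
        · exact mul_nonneg (by positivity) ((hπη0 η hη).trans (hπη η hη))
    _ = _ := by
        rw [sub_eq_add_neg k, sub_eq_add_neg r, Real.rpow_add hα, Real.rpow_add hη0]
        ring

theorem stmt_3 (n : ℕ) (hn : 2 ≤ n) (x : Fin n → ℝ) (hx : ∀ i, 0 < x i)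
    (hne : ∃ i j, x i ≠ x j)
    (k r₀ rinf : ℝ)
    (πα πη : ℝ → ℝ) (hπαpos : ∀ α : ℝ, 0 < α → 0 < πα α)
    (hπα : PropOn πα (fun α => α ^ k) (Set.Ioi 0))
    (hπη : ContinuousOn πη (Set.Ioi 0)) (hπηpos : ∀ η : ℝ, 0 < η → 0 < πη η)
    (hprop0 : PropAt πη (fun η => η ^ r₀) (nhdsWithin 0 (Set.Ioi 0)))
    (hpropInf : PropAt πη (fun η => η ^ rinf) Filter.atTop)
    (hr₀ : r₀ > -1)
    (hnbig : (n : ℝ) > max (2 * (rinf + 1)) (k + 1)) :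
    ricianD n x πα πη < ⊤ := by
  obtain ⟨i, j, hxij⟩ := hne
  have hij : i ≠ j := fun h => hxij (congrArg x h)
  obtain ⟨_, K, -, -, hK⟩ := hπα
  obtain ⟨M₀, hM₀⟩ := exists_le_mul_rpow_on_Ioc hπη hprop0
  obtain ⟨M₁, hM₁⟩ := exists_le_mul_rpow_on_Ioi hπη hpropInf
  have hn1 : 2 * (rinf + 1) < n := (le_max_left _ _).trans_lt hnbig
  have hn2 : k + 1 < n := (le_max_right _ _).trans_lt hnbig
  have hn0 : (2 : ℝ) ≤ n := by exact_mod_cast hn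
  have hc : 0 < (x i - x j) ^ 2 / 4 := by
    have := sub_ne_zero.2 hxij
    positivity
  have hs₀ : ∀ t : ℝ, 0 < t → besselI0 t ≤ Real.exp t * t ^ (-0 : ℝ) := fun t ht => by
    simpa using besselI0_le_exp ht.le
  have hfin₀ : ∫⁻ η in Ioc (0 : ℝ) 1, ENNReal.ofReal (M₀ * η ^ (r₀ - 0 * n)) < ⊤ := by
    refine IntegrableOn.setLIntegral_lt_top (Integrable.const_mul ?_ _)
    rw [zero_mul, sub_zero]
    exact (intervalIntegrable_iff_integrableOn_Ioc_of_le zero_le_one).1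
      (intervalIntegral.intervalIntegrable_rpow' hr₀)
  have hfin₁ : ∫⁻ η in Ioi (1 : ℝ), ENNReal.ofReal (M₁ * η ^ (rinf - 1 / 2 * n)) < ⊤ :=
    IntegrableOn.setLIntegral_lt_top
      ((integrableOn_Ioi_rpow_of_lt (by linarith) zero_lt_one).const_mul _)
  have hle : ricianD n x πα πη ≤ ∫⁻ α in Ioi (0 : ℝ),
      (ENNReal.ofReal (α ^ (k - 2 * n * (1 - 0)) * Real.exp (-((x i - x j) ^ 2 / 4 / α ^ 2))) *
        (ENNReal.ofReal (K * ∏ l, x l ^ (1 - 0 : ℝ)) *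
          ∫⁻ η in Ioc (0 : ℝ) 1, ENNReal.ofReal (M₀ * η ^ (r₀ - 0 * n))) +
      ENNReal.ofReal (α ^ (k - 2 * n * (1 - 1 / 2)) *
        Real.exp (-((x i - x j) ^ 2 / 4 / α ^ 2))) *
        (ENNReal.ofReal (K * ∏ l, x l ^ (1 - 1 / 2 : ℝ)) *
          ∫⁻ η in Ioi (1 : ℝ), ENNReal.ofReal (M₁ * η ^ (rinf - 1 / 2 * n)))) := by
    refine setLIntegral_mono' measurableSet_Ioi fun α hα => ?_
    have hα0 : 0 < α := hα
    nth_rewrite 1 [← Ioc_union_Ioi_eq_Ioi (zero_le_one (α := ℝ))]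
    refine (lintegral_union_le _ _ _).trans (add_le_add ?_ ?_)
    · exact lintegral_rician_le hx hij hs₀ measurableSet_Ioc Ioc_subset_Ioi_self
        (fun η hη => (hπηpos η hη.1).le) hM₀ hα0 (hπαpos α hα0).le (hK α hα).2
    · exact lintegral_rician_le hx hij (fun t => besselI0_le_exp_mul_rpow) measurableSet_Ioi
        (Ioi_subset_Ioi zero_le_one) (fun η hη => (hπηpos η (zero_lt_one.trans hη)).le) hM₁ hα0
        (hπαpos α hα0).le (hK α hα).2
  refine hle.trans_lt ?_
  rw [lintegral_add_left (by fun_prop),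
    lintegral_mul_const _ (by fun_prop), lintegral_mul_const _ (by fun_prop)]
  refine ENNReal.add_lt_top.2 ⟨ENNReal.mul_lt_top ?_ (ENNReal.mul_lt_top ENNReal.ofReal_lt_top
    hfin₀), ENNReal.mul_lt_top ?_ (ENNReal.mul_lt_top ENNReal.ofReal_lt_top hfin₁)⟩
  · exact lintegral_rpow_mul_exp_neg_div_sq_lt_top (by linarith) hc
  · exact lintegral_rpow_mul_exp_neg_div_sq_lt_top (by linarith) hc
end

section
/- The function y ↦ e^{−y} I₀(y) is proportional to 1/√y as y → ∞; precisely, liminf_{y→∞} √y · e^{−y} · I₀(y) > 0 and limsup_{y→∞} √y · e^{−y} · I₀(y) < ∞. -/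
open Filter

/-- The coefficient of `y ^ (2 * m) / (2 * m)!` in `besselI0 y`. -/
noncomputable def normalizedCentralBinom (m : ℕ) : ℝ := Nat.centralBinom m / 4 ^ m

theorem normalizedCentralBinom_pos (m : ℕ) : 0 < normalizedCentralBinom m := by
  have := Nat.centralBinom_pos m
  unfold normalizedCentralBinom
  positivity

theorem normalizedCentralBinom_succ (m : ℕ) :
    normalizedCentralBinom (m + 1) = normalizedCentralBinom m * ((2 * m + 1) / (2 * m + 2)) := by
  have h : ((m : ℝ) + 1) * Nat.centralBinom (m + 1) = 2 * (2 * m + 1) * Nat.centralBinom m := by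
    exact_mod_cast Nat.succ_mul_centralBinom_succ m
  have h' : (Nat.centralBinom (m + 1) : ℝ) = 2 * (2 * m + 1) * Nat.centralBinom m / (m + 1) := by
    rw [← h]
    field_simp
  rw [normalizedCentralBinom, normalizedCentralBinom, h', pow_succ]
  field_simp
  ring

theorem normalizedCentralBinom_sq_mul_le_one (m : ℕ) :
    normalizedCentralBinom m ^ 2 * (2 * m + 1) ≤ 1 := by
  induction m with
  | zero => simp [normalizedCentralBinom]
  | succ m ih =>
    refine le_trans ?_ ih
    rw [normalizedCentralBinom_succ, mul_pow, mul_assoc]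
    gcongr
    rw [div_pow, div_mul_eq_mul_div, div_le_iff₀ (by positivity)]
    push_cast
    have : (0 : ℝ) ≤ m := by positivity
    nlinarith

theorem one_le_normalizedCentralBinom_sq_mul (m : ℕ) :
    1 ≤ normalizedCentralBinom m ^ 2 * (4 * m + 1) := by
  induction m with
  | zero => simp [normalizedCentralBinom]
  | succ m ih =>
    refine le_trans ih ?_
    rw [normalizedCentralBinom_succ, mul_pow, mul_assoc]
    gcongr
    rw [div_pow, div_mul_eq_mul_div, le_div_iff₀ (by positivity)]
    push_cast
    have : (0 : ℝ) ≤ m := by positivity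
    nlinarith

theorem besselI0_term_eq_s9 (y : ℝ) (m : ℕ) :
    (y / 2) ^ (2 * m) / (Nat.factorial m : ℝ) ^ 2 =
      normalizedCentralBinom m * (y ^ (2 * m) / (Nat.factorial (2 * m) : ℝ)) := by
  have h : (Nat.centralBinom m : ℝ) * (Nat.factorial m : ℝ) ^ 2 = Nat.factorial (2 * m) := by
    have := Nat.choose_mul_factorial_mul_factorial (show m ≤ 2 * m by omega)
    rw [show 2 * m - m = m by omega, ← Nat.centralBinom_eq_two_mul_choose] at this
    rw [← this]
    push_cast
    ring
  have hc : (Nat.centralBinom m : ℝ) ≠ 0 := by exact_mod_cast Nat.centralBinom_ne_zero m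
  rw [normalizedCentralBinom, ← h, div_pow, pow_mul 2]
  norm_num
  field_simp

theorem sqrt_mul_normalizedCentralBinom_le {y : ℝ} (hy : 0 < y) (m : ℕ) :
    √y * normalizedCentralBinom m ≤ (1 + y / (2 * m + 1)) / 2 := by
  refine le_of_pow_le_pow_left₀ two_ne_zero (by positivity) ?_
  rw [mul_pow, Real.sq_sqrt hy.le]
  have h : normalizedCentralBinom m ^ 2 ≤ 1 / (2 * m + 1) := by
    rw [le_div_iff₀ (by positivity)]
    exact normalizedCentralBinom_sq_mul_le_one m
  have h' := mul_le_mul_of_nonneg_left h hy.le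
  rw [mul_one_div] at h'
  nlinarith [sq_nonneg (1 - y / (2 * m + 1))]

theorem le_sqrt_mul_normalizedCentralBinom {y : ℝ} (hy : 0 < y) (m : ℕ) :
    (3 - (2 * m + 1) / y) / 4 ≤ √y * normalizedCentralBinom m := by
  have ha := normalizedCentralBinom_pos m
  have hsq : 1 ≤ (2 * (√y * normalizedCentralBinom m)) ^ 2 * ((2 * m + 1) / y) := by
    rw [mul_pow, mul_pow, Real.sq_sqrt hy.le]
    have h := one_le_normalizedCentralBinom_sq_mul m
    have he : 2 ^ 2 * (y * normalizedCentralBinom m ^ 2) * ((2 * m + 1) / y) =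
        4 * (normalizedCentralBinom m ^ 2 * (2 * m + 1)) := by
      field_simp
      norm_num
    rw [he]
    nlinarith [sq_nonneg (normalizedCentralBinom m)]
  have hu : 0 < 2 * (√y * normalizedCentralBinom m) := by positivity
  have ht : 0 < (2 * m + 1) / y := by positivity
  generalize (2 * m + 1) / y = t at *
  generalize √y * normalizedCentralBinom m = u at *
  by_contra! hlt
  have h3 : (2 * u) ^ 2 < ((3 - t) / 2) ^ 2 := by
    apply pow_lt_pow_left₀ _ hu.le two_ne_zero
    linarith
  have h4 : (2 * u) ^ 2 * t < ((3 - t) / 2) ^ 2 * t := by gcongr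
  nlinarith [mul_nonneg (sq_nonneg (t - 1)) (show 0 ≤ 4 - t by linarith)]

theorem hasSum_two_mul_add_one_mul_pow_div_factorial (y : ℝ) :
    HasSum (fun m : ℕ => (2 * m + 1 : ℝ) * (y ^ (2 * m) / (Nat.factorial (2 * m) : ℝ)))
      (y * Real.sinh y + Real.cosh y) := by
  have h : HasSum (fun m : ℕ => (2 * m : ℝ) * (y ^ (2 * m) / (Nat.factorial (2 * m) : ℝ)))
      (y * Real.sinh y) := by
    rw [← hasSum_nat_add_iff' 1]
    simp only [Finset.sum_range_one, Nat.cast_zero, mul_zero, zero_mul, sub_zero]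
    refine (congrArg (HasSum · (y * Real.sinh y)) (funext fun m => ?_)).mpr
      ((Real.hasSum_sinh y).mul_left y)
    rw [show 2 * (m + 1) = 2 * m + 1 + 1 by ring, Nat.factorial_succ (2 * m + 1)]
    push_cast
    have : (2 * m + 1 + 1 : ℝ) ≠ 0 := by positivity
    field_simp
    ring
  convert h.add (Real.hasSum_cosh y) using 1
  ext m
  ring

theorem summable_besselI0_term (y : ℝ) :
    Summable fun m : ℕ =>
      normalizedCentralBinom m * (y ^ (2 * m) / (Nat.factorial (2 * m) : ℝ)) := by
  have hev (m : ℕ) : 0 ≤ y ^ (2 * m) := (even_two_mul m).pow_nonneg y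
  refine (Real.hasSum_cosh y).summable.of_nonneg_of_le (fun m => ?_) (fun m => ?_)
  · have := hev m
    have := normalizedCentralBinom_pos m
    positivity
  · refine mul_le_of_le_one_left (div_nonneg (hev m) (by positivity)) ?_
    rw [normalizedCentralBinom, div_le_one (by positivity)]
    exact_mod_cast Nat.centralBinom_le_four_pow m

theorem hasSum_sqrt_mul_besselI0 (y : ℝ) :
    HasSum (fun m : ℕ =>
      √y * normalizedCentralBinom m * (y ^ (2 * m) / (Nat.factorial (2 * m) : ℝ)))
      (√y * besselI0 y) := by
  simp_rw [besselI0, besselI0_term_eq_s9, mul_assoc]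
  exact (summable_besselI0_term y).hasSum.mul_left _

theorem sqrt_mul_besselI0_le {y : ℝ} (hy : 0 < y) : √y * besselI0 y ≤ Real.exp y / 2 := by
  rw [← Real.cosh_add_sinh]
  refine hasSum_le (fun m => ?_) (hasSum_sqrt_mul_besselI0 y)
    (((Real.hasSum_cosh y).add (Real.hasSum_sinh y)).div_const 2)
  refine (mul_le_mul_of_nonneg_right (sqrt_mul_normalizedCentralBinom_le hy m)
    (by positivity)).trans_eq ?_
  rw [Nat.factorial_succ]
  push_cast
  field_simp
  ring

theorem le_sqrt_mul_besselI0 {y : ℝ} (hy : 1 ≤ y) : Real.exp y / 8 ≤ √y * besselI0 y := by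
  have hy0 : 0 < y := by linarith
  have h : (3 * Real.cosh y - (y * Real.sinh y + Real.cosh y) / y) / 4 ≤ √y * besselI0 y := by
    refine hasSum_le (fun m => ?_)
      ((((Real.hasSum_cosh y).mul_left 3).sub
        ((hasSum_two_mul_add_one_mul_pow_div_factorial y).div_const y)).div_const 4)
      (hasSum_sqrt_mul_besselI0 y)
    refine Eq.trans_le ?_ (mul_le_mul_of_nonneg_right (le_sqrt_mul_normalizedCentralBinom hy0 m)
      (by positivity))
    ring
  refine le_trans ?_ h
  have hc : Real.cosh y / y ≤ Real.cosh y := div_le_self (Real.cosh_pos y).le hy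
  have hs := Real.sinh_lt_cosh y
  rw [add_div, mul_div_cancel_left₀ _ hy0.ne', ← Real.cosh_add_sinh]
  linarith

theorem stmt_9 :
    0 < Filter.liminf
        (fun y : ℝ => ENNReal.ofReal (Real.sqrt y * Real.exp (-y) * besselI0 y))
        Filter.atTop ∧
    Filter.limsup
        (fun y : ℝ => ENNReal.ofReal (Real.sqrt y * Real.exp (-y) * besselI0 y))
        Filter.atTop < ⊤ := by
  have hexp (y : ℝ) : Real.exp (-y) * Real.exp y = 1 := by
    rw [← Real.exp_add, neg_add_cancel, Real.exp_zero]
  constructor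
  · refine lt_of_lt_of_le (b := ENNReal.ofReal (1 / 8)) (by norm_num) ?_
    refine le_liminf_of_le (by isBoundedDefault) ?_
    filter_upwards [eventually_ge_atTop 1] with y hy
    refine ENNReal.ofReal_le_ofReal ?_
    have := mul_le_mul_of_nonneg_left (le_sqrt_mul_besselI0 hy) (Real.exp_pos (-y)).le
    linarith [hexp y]
  · refine lt_of_le_of_lt (b := ENNReal.ofReal (1 / 2)) ?_ ENNReal.ofReal_lt_top
    refine limsup_le_of_le (by isBoundedDefault) ?_
    filter_upwards [eventually_gt_atTop 0] with y hy
    refine ENNReal.ofReal_le_ofReal ?_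
    have := mul_le_mul_of_nonneg_left (sqrt_mul_besselI0_le hy) (Real.exp_pos (-y)).le
    linarith [hexp y]
end

section
/- Let n ≥ 2 and x₁,…,xₙ > 0 be such that not all the x_i are equal, let k ∈ ℝ with n > k + 1, and let r₀ ∈ ℝ. Define c(η) = ∑_{i=1}^n (x_i − η)², h₂(η) = c(η)/(2η), and T(η) = Γ((n−k−1)/2, h₂(η)) / (η^{n/2 − r₀} · c(η)^{(n−k−1)/2}) for η > 0. Then lim_{η→0⁺} T(η) = 0; consequently, setting T(0) = 0, the function T is continuous on [0,1] and ∫₀^1 T(η) dη < ∞. -/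
open MeasureTheory Filter Set

/-- The upper incomplete gamma function `Γ(s,x) = ∫_x^∞ t^(s−1) e^(−t) dt`. -/
noncomputable def upperGamma (s x : ℝ) : ℝ :=
  ∫ t in Set.Ioi x, t ^ (s - 1) * Real.exp (-t)

theorem integrableOn_rpow_sub_one_mul_exp_neg {s : ℝ} (hs : 0 < s) :
    IntegrableOn (fun t : ℝ => t ^ (s - 1) * Real.exp (-t)) (Ioi 0) := by
  simpa only [mul_comm] using Real.GammaIntegral_convergent hs

theorem continuousOn_upperGamma {s : ℝ} (hs : 0 < s) :
    ContinuousOn (upperGamma s) (Ici 0) :=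
  (integrableOn_rpow_sub_one_mul_exp_neg hs).continuousOn_Ici_primitive_Ioi

theorem upperGamma_nonneg (s : ℝ) {x : ℝ} (hx : 0 ≤ x) : 0 ≤ upperGamma s x :=
  setIntegral_nonneg measurableSet_Ioi fun _ ht =>
    mul_nonneg (Real.rpow_nonneg (hx.trans (le_of_lt ht)) _) (Real.exp_pos _).le

/-- Half of the exponential decay of the integrand can be pulled out of `upperGamma`. -/
theorem exists_upperGamma_le_mul_exp {s : ℝ} (hs : 0 < s) :
    ∃ C, 0 ≤ C ∧ ∀ x, 0 ≤ x → upperGamma s x ≤ C * Real.exp (-(x / 2)) := by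
  have hint : IntegrableOn (fun t : ℝ => t ^ (s - 1) * Real.exp (-(t / 2))) (Ioi 0) := by
    refine (integrableOn_rpow_mul_exp_neg_mul_rpow (p := 1) (s := s - 1) (b := 1 / 2)
      (by linarith) one_pos (by norm_num)).congr_fun (fun t _ => ?_) measurableSet_Ioi
    simp only [Real.rpow_one]
    ring_nf
  have hnn : ∀ t ∈ Ioi (0 : ℝ), 0 ≤ t ^ (s - 1) * Real.exp (-(t / 2)) := fun t ht =>
    mul_nonneg (Real.rpow_nonneg (le_of_lt ht) _) (Real.exp_pos _).le
  refine ⟨∫ t in Ioi 0, t ^ (s - 1) * Real.exp (-(t / 2)),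
    setIntegral_nonneg measurableSet_Ioi hnn, fun x hx => ?_⟩
  have hsub : Ioi x ⊆ Ioi 0 := Ioi_subset_Ioi hx
  calc upperGamma s x
      ≤ ∫ t in Ioi x, t ^ (s - 1) * Real.exp (-(t / 2)) * Real.exp (-(x / 2)) := by
        refine setIntegral_mono_on ((integrableOn_rpow_sub_one_mul_exp_neg hs).mono_set hsub)
          ((hint.mono_set hsub).mul_const _) measurableSet_Ioi fun t ht => ?_
        rw [mul_assoc, ← Real.exp_add]
        refine mul_le_mul_of_nonneg_left (Real.exp_le_exp.2 ?_)
          (Real.rpow_nonneg (hx.trans (le_of_lt ht)) _)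
        linarith [mem_Ioi.1 ht]
    _ = (∫ t in Ioi x, t ^ (s - 1) * Real.exp (-(t / 2))) * Real.exp (-(x / 2)) :=
        integral_mul_const _ _
    _ ≤ _ := by
        refine mul_le_mul_of_nonneg_right ?_ (Real.exp_pos _).le
        exact setIntegral_mono_set hint (ae_restrict_of_forall_mem measurableSet_Ioi hnn)
          hsub.eventuallyLE

theorem exists_pos_le_sum_sub_sq {ι : Type*} [Fintype ι] {x : ι → ℝ}
    (hne : ∃ i j, x i ≠ x j) :
    ∃ m, 0 < m ∧ ∀ η, m ≤ ∑ i, (x i - η) ^ 2 := by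
  classical
  obtain ⟨i, j, hij⟩ := hne
  refine ⟨(x i - x j) ^ 2 / 2, by have := sub_ne_zero.2 hij; positivity, fun η => ?_⟩
  have hij' : i ≠ j := fun h => hij (h ▸ rfl)
  have hle : ∑ l ∈ {i, j}, (x l - η) ^ 2 ≤ ∑ l, (x l - η) ^ 2 :=
    Finset.sum_le_sum_of_subset_of_nonneg (Finset.subset_univ _) fun _ _ _ => sq_nonneg _
  rw [Finset.sum_pair hij'] at hle
  nlinarith [sq_nonneg (x i - η + (x j - η))]

theorem stmt_14 (n : ℕ) (hn : 2 ≤ n) (x : Fin n → ℝ) (hx : ∀ i, 0 < x i)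
    (hne : ∃ i j, x i ≠ x j)
    (k r₀ : ℝ) (hk : (n : ℝ) > k + 1)
    (c : ℝ → ℝ) (hc : ∀ η, c η = ∑ i, (x i - η) ^ 2)
    (h₂ : ℝ → ℝ) (hh₂ : ∀ η, h₂ η = c η / (2 * η))
    (T : ℝ → ℝ)
    (hT : ∀ η : ℝ, 0 < η →
      T η = upperGamma (((n : ℝ) - k - 1) / 2) (h₂ η) /
        (η ^ ((n : ℝ) / 2 - r₀) * (c η) ^ (((n : ℝ) - k - 1) / 2)))
    (hT0 : T 0 = 0) :
    Filter.Tendsto T (nhdsWithin 0 (Set.Ioi 0)) (nhds 0) ∧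
    ContinuousOn T (Set.Icc 0 1) ∧
    (∫⁻ η in Set.Ioo (0 : ℝ) 1, ENNReal.ofReal (T η)) < ⊤ := by
  obtain ⟨m, hm, hmc'⟩ := exists_pos_le_sum_sub_sq hne
  have hmc : ∀ η, m ≤ c η := fun η => (hmc' η).trans_eq (hc η).symm
  have hcpos : ∀ η, 0 < c η := fun η => hm.trans_le (hmc η)
  have hccont : Continuous c := by
    rw [funext hc]
    fun_prop
  obtain rfl : h₂ = fun η => c η / (2 * η) := funext hh₂
  have hs : 0 < ((n : ℝ) - k - 1) / 2 := by linarith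
  generalize ((n : ℝ) - k - 1) / 2 = s at hT hs
  generalize (n : ℝ) / 2 - r₀ = p at hT
  obtain ⟨C, hC, hbound⟩ := exists_upperGamma_le_mul_exp hs
  have hlim : Tendsto T (nhdsWithin 0 (Ioi 0)) (nhds 0) := by
    have hmaj : Tendsto (fun η : ℝ => C / m ^ s * (η⁻¹ ^ p * Real.exp (-(m / 4) * η⁻¹)))
        (nhdsWithin 0 (Ioi 0)) (nhds 0) := by
      simpa using ((tendsto_rpow_mul_exp_neg_mul_atTop_nhds_zero p (m / 4)
        (by positivity)).comp tendsto_inv_nhdsGT_zero).const_mul (C / m ^ s)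
    refine squeeze_zero' ?_ ?_ hmaj <;>
      filter_upwards [self_mem_nhdsWithin] with η hη <;>
      have hη : 0 < η := hη <;>
      have hh : 0 ≤ c η / (2 * η) := div_nonneg (hcpos η).le (by positivity) <;>
      rw [hT η hη]
    · have := hcpos η
      exact div_nonneg (upperGamma_nonneg s hh) (by positivity)
    · have hexp : Real.exp (-(c η / (2 * η) / 2)) ≤ Real.exp (-(m / 4) * η⁻¹) := by
        refine Real.exp_le_exp.2 ?_
        have := mul_le_mul_of_nonneg_right (hmc η) (inv_pos.2 hη).le
        have h : c η / (2 * η) / 2 = c η * η⁻¹ / 4 := by field_simp; norm_num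
        linarith
      calc upperGamma s (c η / (2 * η)) / (η ^ p * c η ^ s)
          ≤ C * Real.exp (-(m / 4) * η⁻¹) / (η ^ p * m ^ s) := by
            have := hbound _ hh
            have := mul_le_mul_of_nonneg_left hexp hC
            have := Real.rpow_le_rpow hm.le (hmc η) hs.le
            have := Real.rpow_pos_of_pos hη p
            have := Real.rpow_pos_of_pos hm s
            gcongr
            linarith
        _ = C / m ^ s * (η⁻¹ ^ p * Real.exp (-(m / 4) * η⁻¹)) := by
            rw [Real.inv_rpow hη.le]
            field_simp
  have hpos : ContinuousOn T (Ioi 0) := by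
    refine ContinuousOn.congr (ContinuousOn.div ?_ ?_ ?_) fun η hη => hT η hη
    · refine (continuousOn_upperGamma hs).comp (hccont.continuousOn.div (by fun_prop) ?_) ?_
      · intro η hη
        have : 0 < η := hη
        positivity
      · intro η hη
        have : 0 < η := hη
        exact div_nonneg (hcpos η).le (by positivity)
    · exact (continuousOn_id.rpow_const fun η hη => Or.inl (ne_of_gt hη)).mul
        (hccont.continuousOn.rpow_const fun η _ => Or.inl (hcpos η).ne')
    · intro η hη
      have := Real.rpow_pos_of_pos (mem_Ioi.1 hη) p
      have := Real.rpow_pos_of_pos (hcpos η) s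
      positivity
  have hcont : ContinuousOn T (Icc 0 1) := by
    intro η hη
    rcases hη.1.eq_or_lt with rfl | h
    · refine ContinuousWithinAt.mono ?_ Icc_subset_Ici_self
      rw [← continuousWithinAt_Ioi_iff_Ici]
      simpa [ContinuousWithinAt, hT0] using hlim
    · exact (hpos.continuousAt (Ioi_mem_nhds h)).continuousWithinAt
  exact ⟨hlim, hcont, (hcont.integrableOn_Icc.mono_set Ioo_subset_Icc_self).lintegral_lt_top⟩
end
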